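/- arXiv:0809.2903 — 3 statements merged into one kernel-verified Lean document; each statement's English description precedes it below -/
import Mathlib

section
/- Let ℓ ≥ 0, let a > 0, and let V : (0,∞) → ℝ be continuous on (0,a) and on (a,∞) with finite one-sided limits V(a⁻) and V(a⁺) at a. Let ψ : ℝ × (0,∞) → ℝ be such that: (i) for every E, the map r ↦ ψ(E,r) is continuously differentiable on (0,∞), and ψ satisfies ∂²ψ/∂r²(E,r) + (E − V(r) − ℓ(ℓ+1)/r²) ψ(E,r) = 0 for all r ≠ a; (ii) ψ is three times continuously differentiable jointly in (E,r) on ℝ × (0,a) and on ℝ × (a,∞), with all partial derivatives of order ≤ 3 not involving two or more r-derivatives extending continuously across r = a. Let I ⊆ ℝ be an open interval, E_a ∈ I, and let r̄ : I → (0,∞) be a strictly monotone function with ψ(E, r̄(E)) = 0 for all E ∈ I, r̄(E_a) = a, r̄ continuously differentiable in a neighbourhood of E_a with r̄'(E_a) ≠ 0, three times differentiable on each side of E_a with one-sided limits r̄'''(E_a⁺) and r̄'''(E_a⁻), and suppose ∂ψ/∂E(E_a, a) ≠ 0. Then the third derivative of r̄ has the jump r̄'''(E_a⁺) − r̄'''(E_a⁻)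 = 2 (r̄'(E_a))³ (V(r̄(E_a⁺)⁻side) − V(r̄(E_a⁻)⁺side)), where the two one-sided limits of V are V(a⁺) and V(a⁻) matched so that the jump of r̄''' at E_a equals 2 (r̄'(E_a))³ times the jump of V across a traversed in the direction of increasing E along the curve. -/
open Set Filter Topology

namespace ZeroLine

/-- partial derivative in the first variable -/
noncomputable def D1 (F : ℝ × ℝ → ℝ) (p : ℝ × ℝ) : ℝ := deriv (fun E => F (E, p.2)) p.1

/-- partial derivative in the second variable -/
noncomputable def D2 (F : ℝ × ℝ → ℝ) (p : ℝ × ℝ) : ℝ := deriv (fun r => F (p.1, r)) p.2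

lemma D1_eq {F : ℝ × ℝ → ℝ} {p : ℝ × ℝ} (h : DifferentiableAt ℝ F p) :
    D1 F p = fderiv ℝ F p (1, 0) := by
  have h1 : HasDerivAt (fun E : ℝ => ((E, p.2) : ℝ × ℝ)) (1, 0) p.1 :=
    (hasDerivAt_id p.1).prodMk (hasDerivAt_const p.1 p.2)
  exact (HasFDerivAt.comp_hasDerivAt (l := F) p.1 h.hasFDerivAt h1).deriv

lemma D2_eq {F : ℝ × ℝ → ℝ} {p : ℝ × ℝ} (h : DifferentiableAt ℝ F p) :
    D2 F p = fderiv ℝ F p (0, 1) := by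
  have h1 : HasDerivAt (fun r : ℝ => ((p.1, r) : ℝ × ℝ)) (0, 1) p.2 :=
    (hasDerivAt_const p.2 p.1).prodMk (hasDerivAt_id p.2)
  exact (HasFDerivAt.comp_hasDerivAt (l := F) p.2 h.hasFDerivAt h1).deriv

lemma chain {F : ℝ × ℝ → ℝ} {r : ℝ → ℝ} {E r' : ℝ} (h : DifferentiableAt ℝ F (E, r E))
    (hr : HasDerivAt r r' E) :
    HasDerivAt (fun E => F (E, r E)) (D1 F (E, r E) + D2 F (E, r E) * r') E := by
  have h1 : HasDerivAt (fun E : ℝ => ((E, r E) : ℝ × ℝ)) (1, r') E :=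
    (hasDerivAt_id E).prodMk hr
  have h2 := HasFDerivAt.comp_hasDerivAt (l := F) E h.hasFDerivAt h1
  have e : D1 F (E, r E) + D2 F (E, r E) * r' = fderiv ℝ F (E, r E) (1, r') := by
    rw [D1_eq h, D2_eq h]
    have : ((1, r') : ℝ × ℝ) = (1, 0) + r' • (0, 1) := by simp
    rw [this, map_add, map_smul, smul_eq_mul, mul_comm]
  rw [e]
  exact h2

lemma diffAt {n : ℕ} {F : ℝ × ℝ → ℝ} {U : Set (ℝ × ℝ)} (hU : IsOpen U)
    (h : ContDiffOn ℝ (n + 1 : ℕ) F U) {p : ℝ × ℝ} (hp : p ∈ U) : DifferentiableAt ℝ F p :=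
  (h.contDiffAt (hU.mem_nhds hp)).differentiableAt (by simp)

lemma cd_fderiv {n : ℕ} {F : ℝ × ℝ → ℝ} {U : Set (ℝ × ℝ)} (hU : IsOpen U)
    (h : ContDiffOn ℝ (n + 1 : ℕ) F U) (v : ℝ × ℝ) :
    ContDiffOn ℝ n (fun p => fderiv ℝ F p v) U :=
  (h.fderiv_of_isOpen hU (m := n) (by norm_cast)).clm_apply contDiffOn_const

lemma cd_D1 {n : ℕ} {F : ℝ × ℝ → ℝ} {U : Set (ℝ × ℝ)} (hU : IsOpen U)
    (h : ContDiffOn ℝ (n + 1 : ℕ) F U) : ContDiffOn ℝ n (D1 F) U :=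
  (cd_fderiv hU h (1, 0)).congr fun _ hp => D1_eq (diffAt hU h hp)

lemma cd_D2 {n : ℕ} {F : ℝ × ℝ → ℝ} {U : Set (ℝ × ℝ)} (hU : IsOpen U)
    (h : ContDiffOn ℝ (n + 1 : ℕ) F U) : ContDiffOn ℝ n (D2 F) U :=
  (cd_fderiv hU h (0, 1)).congr fun _ hp => D2_eq (diffAt hU h hp)

lemma D_comm {F : ℝ × ℝ → ℝ} {U : Set (ℝ × ℝ)} (hU : IsOpen U)
    (h : ContDiffOn ℝ (2 : ℕ) F U) {p : ℝ × ℝ} (hp : p ∈ U) : D2 (D1 F) p = D1 (D2 F) p := by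
  have hUp := hU.mem_nhds hp
  have e1 : D1 F =ᶠ[𝓝 p] fun q => fderiv ℝ F q (1, 0) := by
    filter_upwards [hUp] with q hq using D1_eq (diffAt hU h hq)
  have e2 : D2 F =ᶠ[𝓝 p] fun q => fderiv ℝ F q (0, 1) := by
    filter_upwards [hUp] with q hq using D2_eq (diffAt hU h hq)
  have hd : DifferentiableAt ℝ (fderiv ℝ F) p :=
    ((h.fderiv_of_isOpen hU (m := 1) (by norm_cast)).contDiffAt hUp).differentiableAt (by simp)
  rw [D2_eq (diffAt (n := 0) hU (cd_D1 hU h) hp), D1_eq (diffAt (n := 0) hU (cd_D2 hU h) hp),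
    e1.fderiv_eq, e2.fderiv_eq, fderiv_clm_apply hd (by fun_prop),
    fderiv_clm_apply hd (by fun_prop)]
  have hs : IsSymmSndFDerivAt ℝ F p :=
    (h.contDiffAt hUp).isSymmSndFDerivAt (by simp)
  simpa using hs.eq (0, 1) (1, 0)

/-- `D1` only sees the horizontal line; on open sets it respects equality. -/
lemma D1_congr {F G : ℝ × ℝ → ℝ} {U : Set (ℝ × ℝ)} (hU : IsOpen U)
    (h : ∀ p ∈ U, F p = G p) {p : ℝ × ℝ} (hp : p ∈ U) : D1 F p = D1 G p := by
  have hc : Tendsto (fun E : ℝ => ((E, p.2) : ℝ × ℝ)) (𝓝 p.1) (𝓝 p) := by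
    have : Continuous (fun E : ℝ => ((E, p.2) : ℝ × ℝ)) := by fun_prop
    exact this.tendsto p.1
  refine Filter.EventuallyEq.deriv_eq ?_
  filter_upwards [hc (hU.mem_nhds hp)] with E hE using h _ hE

lemma iter_succ (F : ℝ × ℝ → ℝ) (i : ℕ) :
    (fun p : ℝ × ℝ => deriv^[i + 1] (fun E => F (E, p.2)) p.1)
      = fun p : ℝ × ℝ => deriv^[i] (fun E => D1 F (E, p.2)) p.1 := rfl

lemma cont_iter {F : ℝ × ℝ → ℝ} {S : Set (ℝ × ℝ)} {x : ℝ × ℝ} (hS : S ∈ 𝓝 x) {i : ℕ}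
    (h : ContinuousOn (fun p : ℝ × ℝ => deriv^[i] (fun E => F (E, p.2)) p.1) S) :
    Tendsto (D1^[i] F) (𝓝 x) (𝓝 (D1^[i] F x)) := by
  have e : ∀ (i : ℕ) (F : ℝ × ℝ → ℝ),
      (fun p : ℝ × ℝ => deriv^[i] (fun E => F (E, p.2)) p.1) = D1^[i] F := by
    intro i
    induction i with
    | zero => intro F; rfl
    | succ k ih => intro F; rw [iter_succ, ih, Function.iterate_succ_apply]
  rw [e] at h
  exact (h.continuousAt hS).tendsto

/-- the three differentiated identities along the curve -/
lemma identities {F : ℝ × ℝ → ℝ} {U : Set (ℝ × ℝ)} (hU : IsOpen U)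
    (h : ContDiffOn ℝ (3 : ℕ) F U) {J : Set ℝ} (hJ : IsOpen J) {r : ℝ → ℝ}
    (hr : ∀ E ∈ J, DifferentiableAt ℝ r E ∧
      DifferentiableAt ℝ (deriv r) E ∧ DifferentiableAt ℝ (deriv (deriv r)) E)
    (hrU : ∀ E ∈ J, (E, r E) ∈ U) (h0 : ∀ E ∈ J, F (E, r E) = 0)
    (Q : ℝ → ℝ)
    (h22 : ∀ p ∈ U, D2 (D2 F) p = -((p.1 - Q p.2) * F p)) :
    ∀ E ∈ J,
      D1 F (E, r E) + D2 F (E, r E) * deriv r E = 0 ∧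
      D1 (D1 F) (E, r E) + 2 * D1 (D2 F) (E, r E) * deriv r E
        + D2 F (E, r E) * deriv (deriv r) E = 0 ∧
      D1 (D1 (D1 F)) (E, r E) + 3 * D1 (D1 (D2 F)) (E, r E) * deriv r E
        + 3 * D1 (D2 F) (E, r E) * deriv (deriv r) E
        + 2 * (E - Q (r E)) * deriv r E ^ 3 * D2 F (E, r E)
        + D2 F (E, r E) * deriv (deriv (deriv r)) E = 0 := by
  have key : ∀ (g : ℝ → ℝ), (∀ E ∈ J, g E = 0) → ∀ E ∈ J, ∀ g', HasDerivAt g g' E → g' = 0 := by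
    intro g hg E hE g' hg'
    have : g =ᶠ[𝓝 E] fun _ => 0 := by filter_upwards [hJ.mem_nhds hE] with x hx using hg x hx
    exact hg'.unique ((hasDerivAt_const E (0:ℝ)).congr_of_eventuallyEq this)
  have h1 := cd_D1 (n := 2) hU h
  have h2 := cd_D2 (n := 2) hU h
  have h11 := cd_D1 (n := 1) hU h1
  have h12 := cd_D1 (n := 1) hU h2
  have h22' := cd_D2 (n := 1) hU h2
  have hz : ∀ E ∈ J, D2 (D2 F) (E, r E) = 0 := fun E hE => by
    rw [h22 _ (hrU E hE), h0 E hE]; simp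
  have i1 : ∀ E ∈ J, D1 F (E, r E) + D2 F (E, r E) * deriv r E = 0 := fun E hE =>
    key _ h0 E hE _ (chain (diffAt (n := 2) hU h (hrU E hE)) (hr E hE).1.hasDerivAt)
  have hs : ∀ p ∈ U, D2 (D1 F) p = D1 (D2 F) p := fun p hp =>
    D_comm hU (h.of_le (by norm_cast)) hp
  have i2 : ∀ E ∈ J, D1 (D1 F) (E, r E) + 2 * D1 (D2 F) (E, r E) * deriv r E
        + D2 F (E, r E) * deriv (deriv r) E = 0 := fun E hE => by
    have hr1 := (hr E hE).1.hasDerivAt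
    have := key _ i1 E hE _ ((chain (diffAt (n := 1) hU h1 (hrU E hE)) hr1).add
      ((chain (diffAt (n := 1) hU h2 (hrU E hE)) hr1).mul (hr E hE).2.1.hasDerivAt))
    rw [hz E hE, hs _ (hrU E hE)] at this
    linear_combination this
  refine fun E hE => ⟨i1 E hE, i2 E hE, ?_⟩
  have hr1 := (hr E hE).1.hasDerivAt
  have hp := hrU E hE
  have := key _ i2 E hE _ (((chain (diffAt (n := 0) hU h11 hp) hr1).add
      (((chain (diffAt (n := 0) hU h12 hp) hr1).const_mul 2).mul (hr E hE).2.1.hasDerivAt)).add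
      ((chain (diffAt (n := 1) hU h2 hp) hr1).mul (hr E hE).2.2.hasDerivAt))
  have s1 : D2 (D1 (D1 F)) (E, r E) = D1 (D1 (D2 F)) (E, r E) := by
    rw [D_comm hU h1 hp]; exact D1_congr hU hs hp
  have s2 : D2 (D1 (D2 F)) (E, r E) = -((E - Q (r E)) * D1 F (E, r E)) := by
    rw [D_comm hU h2 hp, D1_congr hU h22 hp]
    have hF : HasDerivAt (fun x => F (x, r E)) (D1 F (E, r E)) E := by
      have := chain (r := fun _ => r E) (diffAt (n := 2) hU h hp) (hasDerivAt_const E (r E))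
      simpa using this
    have hG := (((hasDerivAt_id E).sub_const (Q (r E))).mul hF).neg
    refine hG.deriv.trans ?_
    simp [h0 E hE]
  rw [s1, s2, hz E hE] at this
  linear_combination this + 2 * (E - Q (r E)) * deriv r E ^ 2 * i1 E hE

end ZeroLine

set_option maxHeartbeats 1000000 in
/-- Jump relation for the third derivative of a monotone line of zeros
`E ↦ r̄(E)` across the energy `E_a` at which the line crosses a discontinuity
point `a` of the potential:
`r̄'''(E_a⁺) − r̄'''(E_a⁻) = 2 (r̄'(E_a))³ (W⁺ − W⁻)`,
where `W⁺ = lim_{E→E_a⁺} V(r̄(E))` and `W⁻ = lim_{E→E_a⁻} V(r̄(E))` are the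
one-sided limits of `V` across `a` traversed in the direction of increasing `E`
along the curve (they coincide with `V(a⁺)` and `V(a⁻)` matched according to
the monotonicity of `r̄`). -/
theorem jump_third_deriv_of_zero_line
    (ℓ : ℝ) (hℓ : 0 ≤ ℓ) (a : ℝ) (ha : 0 < a)
    (V : ℝ → ℝ) (Vm Vp : ℝ)
    -- V is continuous on (0,a) and (a,∞) with one-sided limits Vm = V(a⁻), Vp = V(a⁺)
    (hVc₁ : ContinuousOn V (Set.Ioo 0 a))
    (hVc₂ : ContinuousOn V (Set.Ioi a))
    (hVm : Tendsto V (nhdsWithin a (Set.Iio a)) (nhds Vm))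
    (hVp : Tendsto V (nhdsWithin a (Set.Ioi a)) (nhds Vp))
    (ψ : ℝ → ℝ → ℝ)
    -- (i) for each E, ψ(E,·) is C¹ on (0,∞) and solves the Schrödinger equation off r = a
    (hψC1 : ∀ E, ContDiffOn ℝ 1 (ψ E) (Set.Ioi 0))
    (hODE : ∀ E, ∀ r ∈ Set.Ioi (0 : ℝ), r ≠ a →
      deriv (deriv (ψ E)) r + (E - V r - ℓ * (ℓ + 1) / r ^ 2) * ψ E r = 0)
    -- (ii) ψ is jointly C³ on ℝ × (0,a) and on ℝ × (a,∞)
    (hψC3₁ : ContDiffOn ℝ 3 (fun p : ℝ × ℝ => ψ p.1 p.2) (Set.univ ×ˢ Set.Ioo 0 a))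
    (hψC3₂ : ContDiffOn ℝ 3 (fun p : ℝ × ℝ => ψ p.1 p.2) (Set.univ ×ˢ Set.Ioi a))
    -- partial derivatives of order ≤ 3 involving at most one r-derivative extend
    -- continuously across r = a:
    (hcontE : ∀ i : ℕ, i ≤ 3 → ContinuousOn
      (fun p : ℝ × ℝ => deriv^[i] (fun E => ψ E p.2) p.1)
      (Set.univ ×ˢ Set.Ioi 0))
    (hcontEr : ∀ i : ℕ, i ≤ 2 → ContinuousOn
      (fun p : ℝ × ℝ => deriv^[i] (fun E => deriv (ψ E) p.2) p.1)
      (Set.univ ×ˢ Set.Ioi 0))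
    -- the strictly monotone line of zeros on an open interval I around E_a
    (I : Set ℝ) (hIopen : IsOpen I) (hIint : I.OrdConnected)
    (Ea : ℝ) (hEa : Ea ∈ I)
    (rbar : ℝ → ℝ)
    (hmono : StrictMonoOn rbar I ∨ StrictAntiOn rbar I)
    (hrpos : ∀ E ∈ I, 0 < rbar E)
    (hzero : ∀ E ∈ I, ψ E (rbar E) = 0)
    (hra : rbar Ea = a)
    (hC1 : ContDiffAt ℝ 1 rbar Ea)
    (hr' : deriv rbar Ea ≠ 0)
    -- three times differentiable on each side of E_a
    (hd3m : ∀ E ∈ I, E < Ea → DifferentiableAt ℝ rbar E ∧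
      DifferentiableAt ℝ (deriv rbar) E ∧ DifferentiableAt ℝ (deriv (deriv rbar)) E)
    (hd3p : ∀ E ∈ I, Ea < E → DifferentiableAt ℝ rbar E ∧
      DifferentiableAt ℝ (deriv rbar) E ∧ DifferentiableAt ℝ (deriv (deriv rbar)) E)
    -- one-sided limits Tm = r̄'''(E_a⁻), Tp = r̄'''(E_a⁺)
    (Tm Tp : ℝ)
    (hTm : Tendsto (deriv (deriv (deriv rbar))) (nhdsWithin Ea (Set.Iio Ea)) (nhds Tm))
    (hTp : Tendsto (deriv (deriv (deriv rbar))) (nhdsWithin Ea (Set.Ioi Ea)) (nhds Tp))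
    -- one-sided limits of V along the curve, traversed in the direction of increasing E
    (Wm Wp : ℝ)
    (hWm : Tendsto (fun E => V (rbar E)) (nhdsWithin Ea (Set.Iio Ea)) (nhds Wm))
    (hWp : Tendsto (fun E => V (rbar E)) (nhdsWithin Ea (Set.Ioi Ea)) (nhds Wp))
    -- the limits along the curve are the one-sided limits of V at a, suitably matched
    (hmatch : (Wp = Vp ∧ Wm = Vm) ∨ (Wp = Vm ∧ Wm = Vp))
    -- nondegeneracy: ∂ψ/∂E(E_a, a) ≠ 0
    (hnd : deriv (fun E => ψ E a) Ea ≠ 0) :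
    Tp - Tm = 2 * (deriv rbar Ea) ^ 3 * (Wp - Wm) := by
  classical
  set F : ℝ × ℝ → ℝ := fun p => ψ p.1 p.2 with hF
  set U : Set (ℝ × ℝ) := Set.univ ×ˢ (Set.Ioo 0 a ∪ Set.Ioi a) with hUdef
  have hU : IsOpen U := isOpen_univ.prod (isOpen_Ioo.union isOpen_Ioi)
  have hU1 : IsOpen ((Set.univ : Set ℝ) ×ˢ Set.Ioo 0 a) := isOpen_univ.prod isOpen_Ioo
  have hU2 : IsOpen ((Set.univ : Set ℝ) ×ˢ Set.Ioi a) := isOpen_univ.prod isOpen_Ioi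
  have hF3 : ContDiffOn ℝ (3 : ℕ) F U := by
    rintro ⟨E, r⟩ ⟨-, hr | hr⟩
    · exact (hψC3₁.contDiffAt (hU1.mem_nhds ⟨trivial, hr⟩)).contDiffWithinAt
    · exact (hψC3₂.contDiffAt (hU2.mem_nhds ⟨trivial, hr⟩)).contDiffWithinAt
  have hJ : IsOpen (I \ {Ea}) := hIopen.sdiff isClosed_singleton
  have hinj : Set.InjOn rbar I := hmono.elim (fun h => h.injOn) (fun h => h.injOn)
  have hrU : ∀ E ∈ I \ {Ea}, (E, rbar E) ∈ U := by
    rintro E ⟨hE, hne⟩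
    have h1 : rbar E ≠ a := fun h => hne (hinj hE hEa (h.trans hra.symm))
    refine ⟨trivial, ?_⟩
    rcases lt_or_gt_of_ne h1 with h | h
    · exact Or.inl ⟨hrpos E hE, h⟩
    · exact Or.inr h
  have hid := ZeroLine.identities hU hF3 hJ (r := rbar)
    (fun E hE => by
      rcases lt_or_gt_of_ne (show E ≠ Ea from hE.2) with h | h
      · exact hd3m E hE.1 h
      · exact hd3p E hE.1 h) hrU (fun E hE => hzero E hE.1)
    (fun r => V r + ℓ * (ℓ + 1) / r ^ 2)
    (by
      rintro ⟨E, r⟩ ⟨-, hr⟩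
      have h0 : 0 < r ∧ r ≠ a := by
        rcases hr with hr | hr
        · exact ⟨hr.1, ne_of_lt hr.2⟩
        · exact ⟨ha.trans hr, ne_of_gt hr⟩
      have := hODE E r h0.1 h0.2
      change deriv (deriv (ψ E)) r = -((E - (V r + ℓ * (ℓ + 1) / r ^ 2)) * ψ E r)
      linear_combination this)
  -- continuity along the curve
  have hcurve : Tendsto (fun E => (E, rbar E)) (𝓝 Ea) (𝓝 (Ea, a)) := by
    have := hC1.continuousAt.tendsto
    rw [hra] at this
    exact tendsto_id.prodMk_nhds this
  have hS : (Set.univ : Set ℝ) ×ˢ Set.Ioi (0:ℝ) ∈ 𝓝 (Ea, a) :=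
    (isOpen_univ.prod isOpen_Ioi).mem_nhds ⟨trivial, ha⟩
  have c1 : Tendsto (fun E => ZeroLine.D1 F (E, rbar E)) (𝓝 Ea) (𝓝 (ZeroLine.D1 F (Ea, a))) :=
    (ZeroLine.cont_iter (F := F) hS (hcontE 1 (by norm_num))).comp hcurve
  have c11 : Tendsto (fun E => ZeroLine.D1 (ZeroLine.D1 F) (E, rbar E)) (𝓝 Ea)
      (𝓝 (ZeroLine.D1 (ZeroLine.D1 F) (Ea, a))) :=
    (ZeroLine.cont_iter (F := F) hS (hcontE 2 (by norm_num))).comp hcurve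
  have c111 : Tendsto (fun E => ZeroLine.D1 (ZeroLine.D1 (ZeroLine.D1 F)) (E, rbar E)) (𝓝 Ea)
      (𝓝 (ZeroLine.D1 (ZeroLine.D1 (ZeroLine.D1 F)) (Ea, a))) :=
    (ZeroLine.cont_iter (F := F) hS (hcontE 3 (by norm_num))).comp hcurve
  have c2 : Tendsto (fun E => ZeroLine.D2 F (E, rbar E)) (𝓝 Ea) (𝓝 (ZeroLine.D2 F (Ea, a))) :=
    (ZeroLine.cont_iter (F := ZeroLine.D2 F) hS (hcontEr 0 (by norm_num))).comp hcurve
  have c12 : Tendsto (fun E => ZeroLine.D1 (ZeroLine.D2 F) (E, rbar E)) (𝓝 Ea)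
      (𝓝 (ZeroLine.D1 (ZeroLine.D2 F) (Ea, a))) :=
    (ZeroLine.cont_iter (F := ZeroLine.D2 F) hS (hcontEr 1 (by norm_num))).comp hcurve
  have c112 : Tendsto (fun E => ZeroLine.D1 (ZeroLine.D1 (ZeroLine.D2 F)) (E, rbar E)) (𝓝 Ea)
      (𝓝 (ZeroLine.D1 (ZeroLine.D1 (ZeroLine.D2 F)) (Ea, a))) :=
    (ZeroLine.cont_iter (F := ZeroLine.D2 F) hS (hcontEr 2 (by norm_num))).comp hcurve
  have cr : Tendsto (deriv rbar) (𝓝 Ea) (𝓝 (deriv rbar Ea)) := by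
    obtain ⟨u, hu, hcu⟩ := hC1.contDiffOn (m := 1) le_rfl (by simp)
    have hu' : u ∈ 𝓝 Ea := by simpa using hu
    obtain ⟨v, hvu, hv, hEv⟩ := mem_nhds_iff.1 hu'
    exact (((hcu.mono hvu).continuousOn_deriv_of_isOpen hv (by simp)).continuousAt
      (hv.mem_nhds hEv)).tendsto
  have cc : Tendsto (fun E => ℓ * (ℓ + 1) / rbar E ^ 2) (𝓝 Ea) (𝓝 (ℓ * (ℓ + 1) / a ^ 2)) := by
    have := hC1.continuousAt.tendsto
    rw [hra] at this
    exact tendsto_const_nhds.div (this.pow 2) (by positivity)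
  have hA1ne : ZeroLine.D1 F (Ea, a) ≠ 0 := hnd
  generalize ZeroLine.D1 F (Ea, a) = A1 at c1 hA1ne
  generalize ZeroLine.D1 (ZeroLine.D1 F) (Ea, a) = A11 at c11
  generalize ZeroLine.D1 (ZeroLine.D1 (ZeroLine.D1 F)) (Ea, a) = A111 at c111
  generalize ZeroLine.D2 F (Ea, a) = A2 at c2
  generalize ZeroLine.D1 (ZeroLine.D2 F) (Ea, a) = A12 at c12
  generalize ZeroLine.D1 (ZeroLine.D1 (ZeroLine.D2 F)) (Ea, a) = A112 at c112
  set p := deriv rbar Ea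
  have main : ∀ (l : Filter ℝ) [l.NeBot], l ≤ 𝓝[≠] Ea → ∀ T W : ℝ,
      Tendsto (deriv (deriv (deriv rbar))) l (𝓝 T) →
      Tendsto (fun E => V (rbar E)) l (𝓝 W) →
      A2 ≠ 0 ∧ A111 + 3 * A112 * p + 3 * A12 * (-(A11 + 2 * A12 * p) / A2)
        + 2 * (Ea - (W + ℓ * (ℓ + 1) / a ^ 2)) * p ^ 3 * A2 + A2 * T = 0 := by
    intro l _ hl T W hT hW
    have hl' : l ≤ 𝓝 Ea := hl.trans nhdsWithin_le_nhds
    have hJl : ∀ᶠ E in l, E ∈ I \ {Ea} := by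
      have h1 : ∀ᶠ E in l, E ∈ I := hl' (hIopen.mem_nhds hEa)
      have h2 : ∀ᶠ E in l, E ∈ ({Ea}ᶜ : Set ℝ) := hl self_mem_nhdsWithin
      filter_upwards [h1, h2] with E h1 h2 using ⟨h1, h2⟩
    have z1 : A1 + A2 * p = 0 := by
      refine tendsto_nhds_unique ((c1.add (c2.mul cr)).mono_left hl') ?_
      refine tendsto_const_nhds.congr' ?_
      filter_upwards [hJl] with E hE using (hid E hE).1.symm
    have hA2 : A2 ≠ 0 := by
      intro h
      rw [h] at z1
      exact hA1ne (by linarith)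
    have hs : Tendsto (deriv (deriv rbar)) l (𝓝 (-(A11 + 2 * A12 * p) / A2)) := by
      have hlim := ((((c11.add ((c12.const_mul 2).mul cr)).neg).div c2 hA2).mono_left hl')
      refine hlim.congr' ?_
      have hne : ∀ᶠ E in l, ZeroLine.D2 F (E, rbar E) ≠ 0 := hl' (c2.eventually_ne hA2)
      filter_upwards [hJl, hne] with E hE hne
      have := (hid E hE).2.1
      simp only [Pi.div_apply]
      rw [div_eq_iff hne]
      linear_combination -this
    refine ⟨hA2, ?_⟩
    have hQ : Tendsto (fun E => E - (V (rbar E) + ℓ * (ℓ + 1) / rbar E ^ 2)) l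
        (𝓝 (Ea - (W + ℓ * (ℓ + 1) / a ^ 2))) :=
      Tendsto.sub hl' (hW.add (cc.mono_left hl'))
    have hlim := ((((c111.mono_left hl').add (((c112.const_mul 3).mul cr).mono_left hl')).add
      (((c12.const_mul 3).mono_left hl').mul hs)).add
      (((hQ.const_mul 2).mul ((cr.pow 3).mono_left hl')).mul (c2.mono_left hl'))).add
      ((c2.mono_left hl').mul hT)
    refine tendsto_nhds_unique hlim ?_
    refine tendsto_const_nhds.congr' ?_
    filter_upwards [hJl] with E hE using (hid E hE).2.2.symm
  obtain ⟨hA2, e1⟩ := main (𝓝[>] Ea) (nhdsWithin_mono _ fun x hx => ne_of_gt hx) Tp Wp hTp hWp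
  obtain ⟨-, e2⟩ := main (𝓝[<] Ea) (nhdsWithin_mono _ fun x hx => ne_of_lt hx) Tm Wm hTm hWm
  refine mul_left_cancel₀ hA2 ?_
  linear_combination e1 - e2
end

section
/- Fix an integer ℓ ≥ 0. Let V₁, V₂ : (0,∞) → ℝ be locally square-integrable potentials each satisfying the integrability conditions ∫₀^a r |Vᵢ(r)| dr < ∞ for every finite a > 0 and ∫_b^∞ |Vᵢ(r)| dr < ∞ for every b > 0. Let ψ₁ and ψ₂ be the regular solutions of the radial Schrödinger equation with potentials V₁ and V₂ respectively and angular momentum ℓ. Suppose the full zero sets of the two families of regular solutions coincide: for every E ∈ ℝ and every r > 0, ψ₁(E,r) = 0 if and only if ψ₂(E,r) = 0; and suppose that for every R > 0 and every integer n ≥ 1 there exists an energy E such that R is the n-th zero of ψ₁(E,·) (i.e. every line of zeros ranges over the whole interval (0,∞)). Then V₁ = V₂ almost everywhere on (0,∞). -/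
open Set Filter Topology MeasureTheory

/-- `ψ` is a regular solution of the radial Schrödinger equation
`ψ'' + (E − V(r) − ℓ(ℓ+1)/r²) ψ = 0` on `(0,∞)` with boundary condition
`ψ(r)/r^(ℓ+1) → 1` as `r → 0⁺`. -/
def IsRegularSolution (V : ℝ → ℝ) (ℓ E : ℝ) (ψ : ℝ → ℝ) : Prop :=
  (∀ r ∈ Set.Ioi (0 : ℝ), DifferentiableAt ℝ ψ r ∧ DifferentiableAt ℝ (deriv ψ) r) ∧
  (∀ r ∈ Set.Ioi (0 : ℝ),
    deriv (deriv ψ) r + (E - V r - ℓ * (ℓ + 1) / r ^ 2) * ψ r = 0) ∧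
  Tendsto (fun r => ψ r / r ^ (ℓ + 1)) (nhdsWithin 0 (Set.Ioi 0)) (nhds 1)

/-- `z` is the `n`-th zero of `f` on `(0,∞)`: `z > 0`, `f z = 0` and there are
exactly `n - 1` zeros of `f` in `(0, z)`. -/
def IsNthZero (f : ℝ → ℝ) (n : ℕ) (z : ℝ) : Prop :=
  0 < z ∧ f z = 0 ∧ {x ∈ Set.Ioo 0 z | f x = 0}.ncard = n - 1

/-- complex amplitude of a solution -/
noncomputable def camp (k : ℝ) (u v : ℝ → ℝ) (r : ℝ) : ℂ :=
  ((v r : ℂ) + Complex.I * ((k * u r : ℝ) : ℂ)) * Complex.exp (-(Complex.I * ((k * r : ℝ) : ℂ)))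

lemma camp_norm (k : ℝ) (u v : ℝ → ℝ) (r : ℝ) :
    ‖camp k u v r‖ = ‖(v r : ℂ) + Complex.I * ((k * u r : ℝ) : ℂ)‖ := by
  have : ‖Complex.exp (-(Complex.I * ((k * r : ℝ) : ℂ)))‖ = 1 := by
    rw [Complex.norm_exp]; simp
  rw [camp, norm_mul, this, mul_one]

lemma camp_bound (k : ℝ) (hk : 0 < k) (u v : ℝ → ℝ) (r : ℝ) :
    |u r| ≤ ‖camp k u v r‖ / k := by
  rw [camp_norm, le_div_iff₀ hk]
  have := Complex.abs_im_le_norm ((v r : ℂ) + Complex.I * ((k * u r : ℝ) : ℂ))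
  simp only [Complex.add_im, Complex.ofReal_im, Complex.mul_im, Complex.I_re, Complex.I_im,
    Complex.ofReal_re] at this
  rw [show |u r| * k = |0 + (0 * 0 + 1 * (k * u r))| by
    rw [zero_mul, zero_add, zero_add, one_mul, abs_mul, abs_of_pos hk, mul_comm]]
  exact this

lemma camp_deriv (k : ℝ) (u v : ℝ → ℝ) (w r : ℝ) (hu : HasDerivAt u (v r) r)
    (hv : HasDerivAt v ((w - k ^ 2) * u r) r) :
    HasDerivAt (camp k u v)
      (((w * u r : ℝ) : ℂ) * Complex.exp (-(Complex.I * ((k * r : ℝ) : ℂ)))) r := by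
  have h1 : HasDerivAt (fun r => (v r : ℂ)) (((w - k ^ 2) * u r : ℝ) : ℂ) r := hv.ofReal_comp
  have h2 : HasDerivAt (fun r => ((k * u r : ℝ) : ℂ)) ((k * v r : ℝ) : ℂ) r :=
    (hu.const_mul k).ofReal_comp
  have h3 : HasDerivAt (fun r : ℝ => ((k * r : ℝ) : ℂ)) ((k * 1 : ℝ) : ℂ) r :=
    ((hasDerivAt_id r).const_mul k).ofReal_comp
  have h4 := ((h3.const_mul Complex.I).neg).cexp
  have h5 := (h1.add (h2.const_mul Complex.I)).mul h4
  refine h5.congr_deriv ?_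
  simp only [Pi.add_apply]
  push_cast
  linear_combination (-(k ^ 2 * u r) * Complex.exp (-(Complex.I * (k * r)))) * Complex.I_sq

lemma camp_approx (k : ℝ) (hk : 0 < k) (u v q g : ℝ → ℝ) (a b η : ℝ) (hab : a ≤ b)
    (hu : ∀ r ∈ Icc a b, HasDerivAt u (v r) r)
    (hv : ∀ r ∈ Icc a b, HasDerivAt v ((q r - k ^ 2) * u r) r)
    (hg : IntegrableOn g (Icc a b)) (hqg : ∀ r ∈ Icc a b, |q r| ≤ g r)
    (hη : η ≤ 1 / 2) (hG : ∫ r in Icc a b, g r ≤ η * k) (r₀ : ℝ) (hr₀ : r₀ ∈ Icc a b)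
    (r : ℝ) (hr : r ∈ Icc a b) :
    ‖camp k u v r - camp k u v r₀‖ ≤ 2 * η * ‖camp k u v r₀‖ := by
  have hd : ∀ r ∈ Icc a b, HasDerivAt (camp k u v)
      (((q r * u r : ℝ) : ℂ) * Complex.exp (-(Complex.I * ((k * r : ℝ) : ℂ)))) r :=
    fun r hr => camp_deriv k u v (q r) r (hu r hr) (hv r hr)
  have hc : ContinuousOn (fun r => ‖camp k u v r‖) (Icc a b) :=
    (HasDerivAt.continuousOn hd).norm
  obtain ⟨m, hm, hmax⟩ := isCompact_Icc.exists_isMaxOn ⟨r₀, hr₀⟩ hc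
  set M := ‖camp k u v m‖ with hM
  have hM0 : 0 ≤ M := norm_nonneg _
  have hle : ∀ r ∈ Icc a b, ‖camp k u v r‖ ≤ M := fun r hr => hmax hr
  have hbd : ∀ r ∈ Icc a b, ‖deriv (camp k u v) r‖ ≤ g r * (M / k) := by
    intro r hr
    rw [(hd r hr).deriv, norm_mul]
    have : ‖Complex.exp (-(Complex.I * ((k * r : ℝ) : ℂ)))‖ = 1 := by
      rw [Complex.norm_exp]; simp
    rw [this, mul_one, Complex.norm_real, Real.norm_eq_abs, abs_mul]
    refine mul_le_mul (hqg r hr) ?_ (abs_nonneg _) ((abs_nonneg _).trans (hqg r hr))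
    exact (camp_bound k hk u v r).trans (div_le_div_of_nonneg_right (hle r hr) hk.le)
  have hgi : IntegrableOn (fun r => g r * (M / k)) (Icc a b) := hg.mul_const _
  have hdi : IntegrableOn (deriv (camp k u v)) (Icc a b) := by
    refine Integrable.mono' hgi (stronglyMeasurable_deriv _).aestronglyMeasurable ?_
    exact (ae_restrict_iff' measurableSet_Icc).2 (Eventually.of_forall hbd)
  have key : ∀ r ∈ Icc a b, ‖camp k u v r - camp k u v r₀‖ ≤ η * M := by
    intro r hr
    have hsub : uIcc r₀ r ⊆ Icc a b := uIcc_subset_Icc hr₀ hr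
    have hsub' : uIoc r₀ r ⊆ Icc a b := uIoc_subset_uIcc.trans hsub
    have hii : IntervalIntegrable (deriv (camp k u v)) volume r₀ r :=
      intervalIntegrable_iff.2 (hdi.mono_set hsub')
    rw [← intervalIntegral.integral_eq_sub_of_hasDerivAt (f := camp k u v)
      (f' := deriv (camp k u v))
      (fun x hx => (hd x (hsub hx)).differentiableAt.hasDerivAt) hii]
    refine intervalIntegral.norm_integral_le_integral_norm_uIoc.trans ?_
    calc ∫ x in uIoc r₀ r, ‖deriv (camp k u v) x‖ 
        ≤ ∫ x in Icc a b, ‖deriv (camp k u v) x‖ :=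
          setIntegral_mono_set hdi.norm (Eventually.of_forall fun _ => norm_nonneg _)
            (LE.le.eventuallyLE hsub')
      _ ≤ ∫ x in Icc a b, g x * (M / k) :=
          setIntegral_mono_on hdi.norm hgi measurableSet_Icc hbd
      _ = (∫ x in Icc a b, g x) * (M / k) := integral_mul_const _ _
      _ ≤ η * k * (M / k) := mul_le_mul_of_nonneg_right hG (by positivity)
      _ = η * M := by field_simp
  have hη0 : 0 ≤ η := by
    have : 0 ≤ ∫ r in Icc a b, g r :=
      setIntegral_nonneg measurableSet_Icc fun r hr => (abs_nonneg _).trans (hqg r hr)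
    exact nonneg_of_mul_nonneg_left (this.trans hG) hk
  have h1 := key m hm
  have h2 : M ≤ ‖camp k u v r₀‖ + ‖camp k u v m - camp k u v r₀‖ := by
    have := norm_add_le (camp k u v r₀) (camp k u v m - camp k u v r₀)
    simpa [hM] using this
  have h3 : M ≤ 2 * ‖camp k u v r₀‖ := by nlinarith
  have := key r hr
  nlinarith

lemma sol_approx (k : ℝ) (u v : ℝ → ℝ) (ε : ℝ) (r₀ r : ℝ)
    (h : ‖camp k u v r - camp k u v r₀‖ ≤ ε * ‖camp k u v r₀‖) :
    |k * u r - (v r₀ * Real.sin (k * (r - r₀)) + k * u r₀ * Real.cos (k * (r - r₀)))|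
      ≤ ε * Real.sqrt (v r₀ ^ 2 + (k * u r₀) ^ 2) := by
  have hn : ‖camp k u v r₀‖ = Real.sqrt (v r₀ ^ 2 + (k * u r₀) ^ 2) := by
    rw [camp_norm, mul_comm Complex.I, Complex.norm_add_mul_I]
  rw [← hn]
  refine le_trans ?_ h
  have he : ‖Complex.exp (Complex.I * ((k * r : ℝ) : ℂ))‖ = 1 := by
    rw [Complex.norm_exp]; simp
  have : ‖camp k u v r - camp k u v r₀‖ =
      ‖(camp k u v r - camp k u v r₀) * Complex.exp (Complex.I * ((k * r : ℝ) : ℂ))‖ := by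
    rw [norm_mul, he, mul_one]
  rw [this]
  refine le_trans (le_of_eq ?_) (Complex.abs_im_le_norm _)
  congr 1
  have h2 : (camp k u v r - camp k u v r₀) * Complex.exp (Complex.I * ((k * r : ℝ) : ℂ)) =
      ((v r : ℂ) + Complex.I * ((k * u r : ℝ) : ℂ)) -
      ((v r₀ : ℂ) + Complex.I * ((k * u r₀ : ℝ) : ℂ)) *
        (Complex.cos ((k * (r - r₀) : ℝ) : ℂ) + Complex.sin ((k * (r - r₀) : ℝ) : ℂ) * Complex.I) := by
    rw [camp, camp, sub_mul, mul_assoc, mul_assoc, ← Complex.exp_add, ← Complex.exp_add,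
      ← Complex.exp_mul_I]
    have e1 : -(Complex.I * ((k * r : ℝ) : ℂ)) + Complex.I * ((k * r : ℝ) : ℂ) = 0 := by ring
    have e2 : -(Complex.I * ((k * r₀ : ℝ) : ℂ)) + Complex.I * ((k * r : ℝ) : ℂ) =
      ((k * (r - r₀) : ℝ) : ℂ) * Complex.I := by push_cast; ring
    rw [e1, e2, Complex.exp_zero, mul_one]
  rw [h2, ← Complex.ofReal_cos, ← Complex.ofReal_sin]
  generalize Real.cos (k * (r - r₀)) = C
  generalize Real.sin (k * (r - r₀)) = S
  simp
  try ring

lemma exists_zero_of_approx (k : ℝ) (hk : 0 < k) (u : ℝ → ℝ) (r₁ r₂ t e : ℝ) (h12 : r₁ ≤ r₂)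
    (hu : ContinuousOn u (Icc r₁ r₂)) (he : e < |t|)
    (h1 : |k * u r₁ - t| ≤ e) (h2 : |k * u r₂ + t| ≤ e) : ∃ z ∈ Icc r₁ r₂, u z = 0 := by
  rw [abs_le] at h1 h2
  rcases le_or_gt 0 t with ht | ht
  · rw [abs_of_nonneg ht] at he
    have a1 : 0 ≤ u r₁ := (pos_of_mul_pos_right (by linarith : 0 < k * u r₁) hk.le).le
    have a2 : u r₂ ≤ 0 := by
      by_contra! h
      nlinarith [mul_pos hk h]
    exact intermediate_value_Icc' h12 hu ⟨a2, a1⟩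
  · rw [abs_of_neg ht] at he
    have a1 : 0 ≤ u r₂ := (pos_of_mul_pos_right (by linarith : 0 < k * u r₂) hk.le).le
    have a2 : u r₁ ≤ 0 := by
      by_contra! h
      nlinarith [mul_pos hk h]
    exact intermediate_value_Icc h12 hu ⟨a2, a1⟩

lemma sin_sq_integral_ge (k z z' : ℝ) (hk : 0 < k) (h1 : z + Real.pi / (2 * k) ≤ z')
    (h2 : z' ≤ z + 3 * Real.pi / (2 * k)) :
    (1 / 3) / k ≤ ∫ r in z..z', (Real.sin (k * (r - z)) ^ 2 - 3 / 100) := by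
  have hd : ∀ r ∈ uIcc z z', HasDerivAt
      (fun r => r / 2 - Real.sin (2 * (k * (r - z))) / (4 * k) - 3 / 100 * r)
      (Real.sin (k * (r - z)) ^ 2 - 3 / 100) r := by
    intro r _
    have e1 : HasDerivAt (fun r : ℝ => 2 * (k * (r - z))) (2 * (k * 1)) r :=
      (((hasDerivAt_id r).sub_const z).const_mul k).const_mul 2
    have e2 := (((hasDerivAt_id r).div_const 2).sub (e1.sin.div_const (4 * k))).sub
      ((hasDerivAt_id r).const_mul (3 / 100))
    refine e2.congr_deriv ?_
    rw [Real.cos_two_mul, Real.cos_sq']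
    field_simp
    ring
  rw [intervalIntegral.integral_eq_sub_of_hasDerivAt hd
    (Continuous.intervalIntegrable (by fun_prop) _ _)]
  simp only [sub_self, mul_zero, Real.sin_zero, zero_div]
  have h3 := Real.sin_le_one (2 * (k * (z' - z)))
  have h4 : Real.sin (2 * (k * (z' - z))) / (4 * k) ≤ 1 / (4 * k) := by gcongr
  have h5 : 3 / (2 * k) ≤ Real.pi / (2 * k) := by gcongr; exact Real.pi_gt_three.le
  have h6 : (1 / 3) / k = (1 / k) * (1 / 3) := by ring
  have h7 : 1 / (4 * k) = (1 / k) * (1 / 4) := by field_simp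
  have h8 : 3 / (2 * k) = (1 / k) * (3 / 2) := by field_simp
  have h9 : 0 < 1 / k := by positivity
  rw [h6]
  rw [h7] at h4
  rw [h8] at h5
  linarith

lemma core_estimate (k x : ℝ) (hk : 1 ≤ k) (u₁ v₁ q₁ u₂ v₂ q₂ g : ℝ → ℝ)
    (hu₁ : ∀ r ∈ Icc x (x + 10), HasDerivAt u₁ (v₁ r) r)
    (hv₁ : ∀ r ∈ Icc x (x + 10), HasDerivAt v₁ ((q₁ r - k ^ 2) * u₁ r) r)
    (hu₂ : ∀ r ∈ Icc x (x + 10), HasDerivAt u₂ (v₂ r) r)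
    (hv₂ : ∀ r ∈ Icc x (x + 10), HasDerivAt v₂ ((q₂ r - k ^ 2) * u₂ r) r)
    (hg : IntegrableOn g (Icc x (x + 10)))
    (hq₁ : ∀ r ∈ Icc x (x + 10), |q₁ r| ≤ g r) (hq₂ : ∀ r ∈ Icc x (x + 10), |q₂ r| ≤ g r)
    (hG : ∫ r in Icc x (x + 10), g r ≤ 1 / 200 * k)
    (hU : IntegrableOn (fun r => q₁ r - q₂ r) (Icc x (x + 10)))
    (hz : ∀ r ∈ Icc x (x + 10), u₁ r = 0 → u₂ r = 0)
    (hn₁ : ∀ r ∈ Icc x (x + 10), u₁ r = 0 → v₁ r ≠ 0)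
    (hn₂ : ∀ r ∈ Icc x (x + 10), u₂ r = 0 → v₂ r ≠ 0) (c : ℝ) :
    |c| / k ≤ 8 * ∫ r in Icc x (x + 10 / k), |(q₁ r - q₂ r) - c| := by
  have hk0 : 0 < k := by linarith
  have hpi : Real.pi < 3.15 := Real.pi_lt_d2
  have hpi0 := Real.pi_pos
  have h10k : 10 / k ≤ 10 := div_le_self (by norm_num) hk
  have hpk : Real.pi / k ≤ 3.15 / k := by gcongr
  have hpk0 : 0 < Real.pi / k := by positivity
  have hpk' : 3.15 / k = 10 / k * 0.315 := by ring
  have hp2 : Real.pi / (2 * k) = Real.pi / k / 2 := by field_simp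
  have hp3 : 3 * Real.pi / (2 * k) = Real.pi / k * (3 / 2) := by field_simp
  have hx : x ∈ Icc x (x + 10) := ⟨le_rfl, by linarith⟩
  have A₁ := fun r₀ h₀ r h => sol_approx k u₁ v₁ _ r₀ r
    (camp_approx k hk0 u₁ v₁ q₁ g x (x + 10) (1 / 200) (by linarith) hu₁ hv₁ hg hq₁
      (by norm_num) hG r₀ h₀ r h)
  have A₂ := fun r₀ h₀ r h => sol_approx k u₂ v₂ _ r₀ r
    (camp_approx k hk0 u₂ v₂ q₂ g x (x + 10) (1 / 200) (by linarith) hu₂ hv₂ hg hq₂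
      (by norm_num) hG r₀ h₀ r h)
  have hc₁ : ContinuousOn u₁ (Icc x (x + 10)) := HasDerivAt.continuousOn hu₁
  have hc₂ : ContinuousOn u₂ (Icc x (x + 10)) := HasDerivAt.continuousOn hu₂
  have t1 : k * (Real.pi / k / 2) = Real.pi / 2 := by field_simp
  have t2 : k * (Real.pi / k) = Real.pi := by field_simp
  have t3 : k * (Real.pi / k * (3 / 2)) = Real.pi / 2 + Real.pi := by field_simp; ring
  obtain ⟨z, hz1, hz2, huz⟩ : ∃ z, x ≤ z ∧ z ≤ x + Real.pi / k * (3 / 2) ∧ u₁ z = 0 := by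
    have hpos : 0 < (v₁ x) ^ 2 + (k * u₁ x) ^ 2 := by
      by_cases h : u₁ x = 0
      · have := hn₁ x hx h
        positivity
      · positivity
    have hsq : ∀ t : ℝ, (v₁ x) ^ 2 + (k * u₁ x) ^ 2 ≤ 2 * t ^ 2 →
        2 * (1 / 200) * Real.sqrt ((v₁ x) ^ 2 + (k * u₁ x) ^ 2) < |t| := by
      intro t ht
      have hs := Real.sqrt_pos.2 hpos
      have hs2 := Real.sq_sqrt hpos.le
      refine abs_lt_of_sq_lt_sq' ?_ (abs_nonneg t) |>.2
      rw [sq_abs]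
      nlinarith
    rcases le_total ((v₁ x) ^ 2) ((k * u₁ x) ^ 2) with h | h
    · have B1 := A₁ x hx x hx
      have B2 := A₁ x hx (x + Real.pi / k) ⟨by linarith, by linarith⟩
      rw [add_sub_cancel_left, t2, Real.sin_pi, Real.cos_pi] at B2
      simp only [sub_self, mul_zero, Real.sin_zero, Real.cos_zero, zero_add, mul_one] at B1
      obtain ⟨z, hz, h0⟩ := exists_zero_of_approx k hk0 u₁ x (x + Real.pi / k) (k * u₁ x) _
        (by linarith) (hc₁.mono (Icc_subset_Icc le_rfl (by linarith))) (hsq _ (by linarith))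
        (by simpa using B1) (by simpa using B2)
      exact ⟨z, hz.1, by linarith [hz.2], h0⟩
    · have B1 := A₁ x hx (x + Real.pi / k / 2) ⟨by linarith, by linarith⟩
      have B2 := A₁ x hx (x + Real.pi / k * (3 / 2)) ⟨by linarith, by linarith⟩
      rw [add_sub_cancel_left, t3, Real.sin_add_pi, Real.cos_add_pi, Real.sin_pi_div_two,
        Real.cos_pi_div_two] at B2
      rw [add_sub_cancel_left, t1, Real.sin_pi_div_two, Real.cos_pi_div_two] at B1
      obtain ⟨z, hz, h0⟩ := exists_zero_of_approx k hk0 u₁ (x + Real.pi / k / 2)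
        (x + Real.pi / k * (3 / 2)) (v₁ x) _
        (by linarith) (hc₁.mono (Icc_subset_Icc (by linarith) (by linarith)))
        (hsq _ (by linarith))
        (by simpa using B1) (by simpa using B2)
      exact ⟨z, by linarith [hz.1], by linarith [hz.2], h0⟩
  have hzI : z ∈ Icc x (x + 10) := ⟨hz1, by linarith⟩
  have huz2 := hz z hzI huz
  have n1 := hn₁ z hzI huz
  have n2 := hn₂ z hzI huz2
  have C₁ : ∀ r ∈ Icc x (x + 10), |k * u₁ r - v₁ z * Real.sin (k * (r - z))| ≤
      1 / 100 * |v₁ z| := by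
    intro r hr
    have := A₁ z hzI r hr
    rw [huz] at this
    simp only [mul_zero, zero_mul, add_zero] at this
    rw [show (0 : ℝ) ^ 2 = 0 by norm_num, add_zero, Real.sqrt_sq_eq_abs] at this
    linarith
  have C₂ : ∀ r ∈ Icc x (x + 10), |k * u₂ r - v₂ z * Real.sin (k * (r - z))| ≤
      1 / 100 * |v₂ z| := by
    intro r hr
    have := A₂ z hzI r hr
    rw [huz2] at this
    simp only [mul_zero, zero_mul, add_zero] at this
    rw [show (0 : ℝ) ^ 2 = 0 by norm_num, add_zero, Real.sqrt_sq_eq_abs] at this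
    linarith
  obtain ⟨z', hz1', hz2', huz'⟩ : ∃ z', z + Real.pi / k / 2 ≤ z' ∧
      z' ≤ z + Real.pi / k * (3 / 2) ∧ u₁ z' = 0 := by
    have B1 := C₁ (z + Real.pi / k / 2) ⟨by linarith, by linarith⟩
    have B2 := C₁ (z + Real.pi / k * (3 / 2)) ⟨by linarith, by linarith⟩
    rw [add_sub_cancel_left, t3, Real.sin_add_pi, Real.sin_pi_div_two] at B2
    rw [add_sub_cancel_left, t1, Real.sin_pi_div_two] at B1
    have := abs_pos.2 n1
    obtain ⟨z', hz', h0⟩ := exists_zero_of_approx k hk0 u₁ (z + Real.pi / k / 2)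
      (z + Real.pi / k * (3 / 2)) (v₁ z) (1 / 100 * |v₁ z|)
      (by linarith) (hc₁.mono (Icc_subset_Icc (by linarith) (by linarith)))
      (by linarith) (by simpa using B1) (by simpa using B2)
    exact ⟨z', hz'.1, hz'.2, h0⟩
  have hzz : z ≤ z' := by linarith
  have hzI' : z' ∈ Icc x (x + 10) := ⟨by linarith, by linarith⟩
  have huz2' := hz z' hzI' huz'
  have hsub : Icc z z' ⊆ Icc x (x + 10) := Icc_subset_Icc hz1 hzI'.2
  set p : ℝ → ℝ := fun r => (k * u₁ r / v₁ z) * (k * u₂ r / v₂ z) with hp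
  have hpc : ContinuousOn p (Icc x (x + 10)) :=
    ((hc₁.const_mul k).div_const _).mul ((hc₂.const_mul k).div_const _)
  have D : ∀ (u v : ℝ → ℝ), v z ≠ 0 → ∀ r, |k * u r - v z * Real.sin (k * (r - z))| ≤
      1 / 100 * |v z| → |k * u r / v z - Real.sin (k * (r - z))| ≤ 1 / 100 := by
    intro u v hv r h
    have : k * u r / v z - Real.sin (k * (r - z)) =
      (k * u r - v z * Real.sin (k * (r - z))) / v z := by field_simp
    rw [this, abs_div, div_le_iff₀ (abs_pos.2 hv)]
    exact h
  have hpb : ∀ r ∈ Icc x (x + 10), Real.sin (k * (r - z)) ^ 2 - 3 / 100 ≤ p r ∧ |p r| ≤ 2 := by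
    intro r hr
    have d1 := D u₁ v₁ n1 r (C₁ r hr)
    have d2 := D u₂ v₂ n2 r (C₂ r hr)
    have s1 := Real.sin_le_one (k * (r - z))
    have s2 := Real.neg_one_le_sin (k * (r - z))
    simp only [hp]
    generalize Real.sin (k * (r - z)) = s at *
    generalize k * u₁ r / v₁ z = X at *
    generalize k * u₂ r / v₂ z = Y at *
    rw [abs_le] at d1 d2
    have hX : |X| ≤ 1.01 := abs_le.2 ⟨by linarith, by linarith⟩
    have hY : |Y| ≤ 1.01 := abs_le.2 ⟨by linarith, by linarith⟩
    constructor
    · have e1 : |s * (Y - s)| ≤ 1 * (1 / 100) := by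
        rw [abs_mul]
        exact mul_le_mul (abs_le.2 ⟨s2, s1⟩) (abs_le.2 d2) (abs_nonneg _) (by norm_num)
      have e2 : |(X - s) * Y| ≤ (1 / 100) * 1.01 := by
        rw [abs_mul]
        exact mul_le_mul (abs_le.2 d1) hY (abs_nonneg _) (by norm_num)
      rw [abs_le] at e1 e2
      nlinarith
    · rw [abs_mul]
      nlinarith [abs_nonneg X, abs_nonneg Y]
  have hpi1 : IntervalIntegrable p volume z z' := by
    apply ContinuousOn.intervalIntegrable
    rw [uIcc_of_le hzz]
    exact hpc.mono hsub
  have hUi : IntervalIntegrable (fun r => q₁ r - q₂ r) volume z z' := by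
    rw [intervalIntegrable_iff_integrableOn_Icc_of_le hzz]
    exact hU.mono_set hsub
  have hUp : IntervalIntegrable (fun r => (q₁ r - q₂ r) * p r) volume z z' := by
    apply hUi.mul_continuousOn
    rw [uIcc_of_le hzz]
    exact hpc.mono hsub
  have hW : ∫ r in z..z', (q₁ r - q₂ r) * p r = 0 := by
    have hd : ∀ r ∈ uIcc z z', HasDerivAt
        (fun r => (v₁ r * u₂ r - u₁ r * v₂ r) * (k ^ 2 / (v₁ z * v₂ z)))
        ((q₁ r - q₂ r) * p r) r := by
      intro r hr
      rw [uIcc_of_le hzz] at hr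
      have hr := hsub hr
      refine ((((hv₁ r hr).mul (hu₂ r hr)).sub ((hu₁ r hr).mul (hv₂ r hr))).mul_const
        (k ^ 2 / (v₁ z * v₂ z))).congr_deriv ?_
      simp only [hp]
      field_simp
      ring
    rw [intervalIntegral.integral_eq_sub_of_hasDerivAt hd hUp]
    simp [huz, huz2, huz', huz2']
  have hlow : (1 / 3) / k ≤ ∫ r in z..z', p r := by
    refine (sin_sq_integral_ge k z z' hk0 (by linarith) (by linarith)).trans ?_
    refine intervalIntegral.integral_mono_on hzz (Continuous.intervalIntegrable (by fun_prop) _ _)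
      hpi1 fun r hr => (hpb r (hsub hr)).1
  have hUc : IntervalIntegrable (fun r => |(q₁ r - q₂ r) - c|) volume z z' :=
    (hUi.sub intervalIntegrable_const).abs
  have heq : c * ∫ r in z..z', p r = - ∫ r in z..z', ((q₁ r - q₂ r) - c) * p r := by
    have : ∀ r, ((q₁ r - q₂ r) - c) * p r = (q₁ r - q₂ r) * p r - c * p r := fun r => by ring
    simp_rw [this]
    rw [intervalIntegral.integral_sub hUp (hpi1.const_mul c), hW,
      intervalIntegral.integral_const_mul]
    ring
  have hup : |∫ r in z..z', ((q₁ r - q₂ r) - c) * p r| ≤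
      ∫ r in z..z', |(q₁ r - q₂ r) - c| * 2 := by
    rw [← Real.norm_eq_abs]
    refine intervalIntegral.norm_integral_le_of_norm_le hzz ?_ (hUc.mul_const 2)
    refine Eventually.of_forall fun r hr => ?_
    rw [Real.norm_eq_abs, abs_mul]
    exact mul_le_mul_of_nonneg_left (hpb r (hsub (Ioc_subset_Icc_self hr))).2 (abs_nonneg _)
  have hfin : ∫ r in z..z', |(q₁ r - q₂ r) - c| ≤
      ∫ r in Icc x (x + 10 / k), |(q₁ r - q₂ r) - c| := by
    rw [intervalIntegral.integral_of_le hzz]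
    refine setIntegral_mono_set ?_ (Eventually.of_forall fun _ => abs_nonneg _)
      (LE.le.eventuallyLE (Ioc_subset_Icc_self.trans (Icc_subset_Icc hz1 (by linarith))))
    have : IntegrableOn (fun r => (q₁ r - q₂ r) - c) (Icc x (x + 10 / k)) :=
      Integrable.sub (hU.mono_set (Icc_subset_Icc le_rfl (by linarith)))
        (integrableOn_const (by simp))
    exact this.abs
  rw [intervalIntegral.integral_mul_const] at hup
  have habs : |c| * ∫ r in z..z', p r = |∫ r in z..z', ((q₁ r - q₂ r) - c) * p r| := by
    rw [← abs_neg (∫ r in z..z', ((q₁ r - q₂ r) - c) * p r), ← heq, abs_mul,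
      abs_of_nonneg (a := ∫ r in z..z', p r)]
    exact le_trans (by positivity) hlow
  have h1 : |c| * ((1 / 3) / k) ≤ |c| * ∫ r in z..z', p r :=
    mul_le_mul_of_nonneg_left hlow (abs_nonneg c)
  have h2 : |c| * ((1 / 3) / k) = (|c| / k) / 3 := by ring
  have h0 : 0 ≤ |c| / k := by positivity
  linarith

lemma reg_deriv (V : ℝ → ℝ) (ℓ k : ℝ) (ψ : ℝ → ℝ) (h : IsRegularSolution V ℓ (k ^ 2) ψ)
    (r : ℝ) (hr : 0 < r) : HasDerivAt ψ (deriv ψ r) r ∧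
      HasDerivAt (deriv ψ) ((V r + ℓ * (ℓ + 1) / r ^ 2 - k ^ 2) * ψ r) r := by
  obtain ⟨h1, h2, -⟩ := h
  refine ⟨(h1 r hr).1.hasDerivAt, ?_⟩
  refine (h1 r hr).2.hasDerivAt.congr_deriv ?_
  have := h2 r hr
  linear_combination this

lemma gpot_integrable (V : ℝ → ℝ) (L : ℝ) (hV : ∀ b : ℝ, 0 < b → IntegrableOn (fun r => |V r|) (Ioi b))
    (a b : ℝ) (ha : 0 < a) : IntegrableOn (fun r => |V r| + |L / r ^ 2|) (Icc a b) := by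
  refine Integrable.add ((hV (a / 2) (by linarith)).mono_set fun r hr => ?_) ?_
  · have := hr.1
    simp only [mem_Ioi]
    linarith
  · apply ContinuousOn.integrableOn_Icc
    apply ContinuousOn.abs
    refine continuousOn_const.div (by fun_prop) fun r hr => ?_
    have := lt_of_lt_of_le ha hr.1
    positivity

lemma reg_nontrivial (V : ℝ → ℝ) (ℓ k : ℝ) (hk : 0 < k) (ψ : ℝ → ℝ)
    (hV : ∀ b : ℝ, 0 < b → IntegrableOn (fun r => |V r|) (Ioi b))
    (h : IsRegularSolution V ℓ (k ^ 2) ψ) (r₀ : ℝ) (hr₀ : 0 < r₀) (h0 : ψ r₀ = 0) :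
    deriv ψ r₀ ≠ 0 := by
  intro h0'
  set c := camp k ψ (deriv ψ) with hc
  set q : ℝ → ℝ := fun r => V r + ℓ * (ℓ + 1) / r ^ 2 with hq
  set g : ℝ → ℝ := fun r => |V r| + |ℓ * (ℓ + 1) / r ^ 2| with hg
  have hcc : ∀ r, 0 < r → ContinuousAt c r := fun r hr =>
    (camp_deriv k ψ (deriv ψ) (q r) r (reg_deriv V ℓ k ψ h r hr).1
      (reg_deriv V ℓ k ψ h r hr).2).continuousAt
  set S : Set ℝ := {r | 0 < r ∧ c r = 0} with hS
  have hgi : ∀ a b, 0 < a → IntegrableOn g (Icc a b) := fun a b ha => gpot_integrable V _ hV a b ha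
  have hopen : IsOpen S := by
    rw [isOpen_iff_mem_nhds]
    rintro s ⟨hs, hs0⟩
    have hF : ContinuousOn (fun b => ∫ r in s..b, g r) (uIcc (s / 2) (2 * s)) := by
      apply intervalIntegral.continuousOn_primitive_interval'
      · rw [intervalIntegrable_iff_integrableOn_Icc_of_le (by linarith)]
        exact hgi _ _ (by linarith)
      · rw [uIcc_of_le (by linarith)]
        exact ⟨by linarith, by linarith⟩
    rw [uIcc_of_le (by linarith)] at hF
    have hF' := (hF.continuousAt (Icc_mem_nhds (by linarith : s / 2 < s) (by linarith)))
    have hev : ∀ᶠ b in 𝓝 s, |∫ r in s..b, g r| < k / 4 := by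
      have := hF'.abs
      apply this.eventually_lt continuousAt_const
      simp only [intervalIntegral.integral_same, abs_zero]
      positivity
    obtain ⟨ε, hε, hb⟩ := Metric.eventually_nhds_iff.1 hev
    set δ := min (ε / 2) (s / 4) with hδ
    have hδ0 : 0 < δ := by positivity
    have hδ1 : δ ≤ ε / 2 := min_le_left _ _
    have hδ2 : δ ≤ s / 4 := min_le_right _ _
    have b1 := hb (y := s + δ) (by rw [Real.dist_eq, add_sub_cancel_left, abs_of_pos hδ0]; linarith)
    have b2 := hb (y := s - δ) (by
      rw [Real.dist_eq, sub_sub_cancel_left, abs_neg, abs_of_pos hδ0]; linarith)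
    have ii : ∀ a b, 0 < a → 0 < b → IntervalIntegrable g volume a b := by
      intro a b ha hb
      rw [intervalIntegrable_iff]
      refine (hgi (min a b) (max a b) (lt_min ha hb)).mono_set ?_
      exact Ioc_subset_Icc_self
    have hG : ∫ r in Icc (s - δ) (s + δ), g r ≤ 1 / 2 * k := by
      rw [integral_Icc_eq_integral_Ioc, ← intervalIntegral.integral_of_le (by linarith),
        ← intervalIntegral.integral_interval_sub_left (ii s _ hs (by linarith))
          (ii s _ hs (by linarith))]
      rw [abs_lt] at b1 b2
      linarith
    filter_upwards [Icc_mem_nhds (by linarith : s - δ < s) (by linarith : s < s + δ)] with r hr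
    have hr0 : 0 < r := by linarith [hr.1]
    refine ⟨hr0, ?_⟩
    have := camp_approx k hk ψ (deriv ψ) q g (s - δ) (s + δ) (1 / 2) (by linarith)
      (fun r hr => (reg_deriv V ℓ k ψ h r (by linarith [hr.1])).1)
      (fun r hr => (reg_deriv V ℓ k ψ h r (by linarith [hr.1])).2)
      (hgi _ _ (by linarith)) (fun r _ => abs_add_le _ _) le_rfl hG s
      ⟨by linarith, by linarith⟩ r hr
    rw [← hc, hs0] at this
    simpa using this
  have hsub : Ioi (0 : ℝ) ⊆ S := by
    refine isPreconnected_Ioi.subset_of_closure_inter_subset hopen ⟨r₀, hr₀, hr₀, ?_⟩ ?_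
    · simp [hc, camp, h0, h0']
    · rintro r ⟨hr, hr0⟩
      refine ⟨hr0, ?_⟩
      by_contra hne
      have h1 := (hcc r hr0).eventually_ne hne
      have h2 := mem_closure_iff_frequently.1 hr
      obtain ⟨y, hy, hy'⟩ := (h2.and_eventually h1).exists
      exact hy' hy.2
  have hzero : ∀ r, 0 < r → ψ r = 0 := by
    intro r hr
    have h1 := camp_bound k hk ψ (deriv ψ) r
    rw [← hc, (hsub hr).2] at h1
    simpa using h1
  have hl := h.2.2
  have : Tendsto (fun r : ℝ => ψ r / r ^ (ℓ + 1)) (𝓝[>] 0) (𝓝 0) := by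
    refine tendsto_const_nhds.congr' ?_
    filter_upwards [self_mem_nhdsWithin] with r hr
    rw [hzero r hr, zero_div]
  exact zero_ne_one (tendsto_nhds_unique this hl)

lemma V_aesm (V : ℝ → ℝ) (ℓ : ℝ) (ψ : ℝ → ℝ)
    (hV : ∀ b : ℝ, 0 < b → IntegrableOn (fun r => |V r|) (Ioi b))
    (h : IsRegularSolution V ℓ (1 ^ 2) ψ) :
    AEStronglyMeasurable V (volume.restrict (Ioi 0)) := by
  have hcount : {r ∈ Ioi (0 : ℝ) | ψ r = 0}.Countable := by
    refine (countable_setOfPred_isolated_right_within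
      (s := {r ∈ Ioi (0 : ℝ) | ψ r = 0})).mono ?_
    rintro r ⟨hr, h0⟩
    refine ⟨⟨hr, h0⟩, ?_⟩
    have hne := (reg_deriv V ℓ 1 ψ h r hr).1.eventually_ne (c := 0)
      (reg_nontrivial V ℓ 1 one_pos ψ hV h r hr h0)
    rw [← empty_mem_iff_bot]
    have h1 : ∀ᶠ y in 𝓝[{r ∈ Ioi (0 : ℝ) | ψ r = 0} ∩ Ioi r] r, ψ y ≠ 0 := by
      refine hne.filter_mono (nhdsWithin_mono _ ?_)
      rintro y ⟨-, hy⟩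
      exact (ne_of_gt hy)
    filter_upwards [h1, self_mem_nhdsWithin] with y hy hy'
    exact hy hy'.1.2
  have hψ : AEStronglyMeasurable ψ (volume.restrict (Ioi 0)) :=
    ContinuousOn.aestronglyMeasurable
      (fun r hr => (reg_deriv V ℓ 1 ψ h r hr).1.continuousAt.continuousWithinAt) measurableSet_Ioi
  have hm : AEStronglyMeasurable (fun r => deriv (deriv ψ) r / ψ r + 1 - ℓ * (ℓ + 1) / r ^ 2)
      (volume.restrict (Ioi 0)) := by
    refine AEMeasurable.aestronglyMeasurable ?_
    refine (((measurable_deriv _).aemeasurable.div hψ.aemeasurable).add_const 1).sub ?_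
    exact Measurable.aemeasurable (by fun_prop)
  refine hm.congr ?_
  rw [EventuallyEq, ae_restrict_iff' measurableSet_Ioi]
  filter_upwards [hcount.ae_notMem volume] with r hr hr0
  have hne : ψ r ≠ 0 := fun h => hr ⟨hr0, h⟩
  rw [(reg_deriv V ℓ 1 ψ h r hr0).2.deriv]
  field_simp
  ring

/-- Knowledge of all the lines of zeros of the regular solution determines a
locally square-integrable potential uniquely: if the full zero sets of the two
families of regular solutions coincide and every line of zeros ranges over the
entire positive axis, then the potentials agree almost everywhere. -/
theorem potential_unique_from_all_lines_of_zeros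
    (ℓ : ℕ)
    (V₁ V₂ : ℝ → ℝ)
    -- locally square integrable
    (hsq₁ : ∀ R : ℝ, 0 < R → IntegrableOn (fun r => (V₁ r) ^ 2) (Set.Ioo 0 R))
    (hsq₂ : ∀ R : ℝ, 0 < R → IntegrableOn (fun r => (V₂ r) ^ 2) (Set.Ioo 0 R))
    -- integrability conditions
    (hint₁ : ∀ a : ℝ, 0 < a → IntegrableOn (fun r => r * |V₁ r|) (Set.Ioo 0 a))
    (hint₁' : ∀ b : ℝ, 0 < b → IntegrableOn (fun r => |V₁ r|) (Set.Ioi b))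
    (hint₂ : ∀ a : ℝ, 0 < a → IntegrableOn (fun r => r * |V₂ r|) (Set.Ioo 0 a))
    (hint₂' : ∀ b : ℝ, 0 < b → IntegrableOn (fun r => |V₂ r|) (Set.Ioi b))
    (ψ₁ ψ₂ : ℝ → ℝ → ℝ)
    (hψ₁ : ∀ E : ℝ, IsRegularSolution V₁ (ℓ : ℝ) E (ψ₁ E))
    (hψ₂ : ∀ E : ℝ, IsRegularSolution V₂ (ℓ : ℝ) E (ψ₂ E))
    -- the full zero sets coincide
    (hzeros : ∀ E : ℝ, ∀ r ∈ Set.Ioi (0 : ℝ), ψ₁ E r = 0 ↔ ψ₂ E r = 0)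
    -- every line of zeros ranges over the whole interval (0,∞)
    (hrange : ∀ R ∈ Set.Ioi (0 : ℝ), ∀ n : ℕ, 1 ≤ n → ∃ E : ℝ, IsNthZero (ψ₁ E) n R) :
    ∀ᵐ r ∂(volume : Measure ℝ), r ∈ Set.Ioi (0 : ℝ) → V₁ r = V₂ r := by
  have hVm₁ := V_aesm V₁ ℓ (ψ₁ (1 ^ 2)) hint₁' (hψ₁ _)
  have hVm₂ := V_aesm V₂ ℓ (ψ₂ (1 ^ 2)) hint₂' (hψ₂ _)
  have hVi₁ : ∀ a : ℝ, 0 < a → IntegrableOn V₁ (Ioi a) := fun a ha =>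
    Integrable.mono' (hint₁' a ha) (hVm₁.mono_set (Ioi_subset_Ioi ha.le))
      (Eventually.of_forall fun r => le_rfl)
  have hVi₂ : ∀ a : ℝ, 0 < a → IntegrableOn V₂ (Ioi a) := fun a ha =>
    Integrable.mono' (hint₂' a ha) (hVm₂.mono_set (Ioi_subset_Ioi ha.le))
      (Eventually.of_forall fun r => le_rfl)
  have main : ∀ n : ℕ, ∀ᵐ x ∂(volume : Measure ℝ), x ∈ Ioi (1 / ((n : ℝ) + 1)) → V₁ x = V₂ x := by
    intro n
    set a : ℝ := 1 / ((n : ℝ) + 1) with ha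
    have ha0 : 0 < a := by positivity
    set f : ℝ → ℝ := (Ioi a).indicator (fun r => V₁ r - V₂ r) with hf
    have hUi : IntegrableOn (fun r => V₁ r - V₂ r) (Ioi a) := (hVi₁ a ha0).sub (hVi₂ a ha0)
    have hfi : Integrable f := (integrable_indicator_iff measurableSet_Ioi).2 hUi
    filter_upwards [IsUnifLocDoublingMeasure.ae_tendsto_average_norm_sub (volume : Measure ℝ)
      hfi.locallyIntegrable 1] with x hx hxa
    have hxa' : a < x := hxa
    have hx0 : 0 < x := ha0.trans hxa'
    have hδ : Tendsto (fun k : ℝ => 10 / k) atTop (𝓝[>] 0) := by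
      rw [tendsto_nhdsWithin_iff]
      refine ⟨tendsto_const_nhds.div_atTop tendsto_id, ?_⟩
      filter_upwards [eventually_gt_atTop 0] with k hk
      exact div_pos (by norm_num) hk
    have hlim := hx (fun _ : ℝ => x) (fun k : ℝ => 10 / k) hδ (by
      filter_upwards [eventually_gt_atTop 0] with k hk
      apply Metric.mem_closedBall_self
      positivity)
    set L : ℝ := (ℓ : ℝ) * ((ℓ : ℝ) + 1) with hL
    set g : ℝ → ℝ := fun r => (|V₁ r| + |L / r ^ 2|) + (|V₂ r| + |L / r ^ 2|) with hg
    have hgi : IntegrableOn g (Icc x (x + 10)) :=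
      (gpot_integrable V₁ L hint₁' _ _ hx0).add (gpot_integrable V₂ L hint₂' _ _ hx0)
    set c := V₁ x - V₂ x with hc
    have hbound : ∀ᶠ k : ℝ in atTop,
        |c| ≤ 160 * ⨍ y in Metric.closedBall x (10 / k), ‖f y - f x‖ := by
      filter_upwards [eventually_ge_atTop 1,
        eventually_ge_atTop (200 * ∫ r in Icc x (x + 10), g r)] with k hk1 hk2
      have hk0 : 0 < k := by linarith
      have hpos : ∀ r ∈ Icc x (x + 10), 0 < r := fun r hr => hx0.trans_le hr.1
      have hcore := core_estimate k x hk1 (ψ₁ (k ^ 2)) (deriv (ψ₁ (k ^ 2)))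
        (fun r => V₁ r + L / r ^ 2) (ψ₂ (k ^ 2)) (deriv (ψ₂ (k ^ 2)))
        (fun r => V₂ r + L / r ^ 2) g
        (fun r hr => (reg_deriv V₁ ℓ k _ (hψ₁ _) r (hpos r hr)).1)
        (fun r hr => (reg_deriv V₁ ℓ k _ (hψ₁ _) r (hpos r hr)).2)
        (fun r hr => (reg_deriv V₂ ℓ k _ (hψ₂ _) r (hpos r hr)).1)
        (fun r hr => (reg_deriv V₂ ℓ k _ (hψ₂ _) r (hpos r hr)).2)
        hgi
        (fun r _ => (abs_add_le _ _).trans (le_add_of_nonneg_right (by positivity)))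
        (fun r _ => (abs_add_le _ _).trans (le_add_of_nonneg_left (by positivity)))
        (by linarith)
        (by
          simp only [add_sub_add_right_eq_sub]
          exact hUi.mono_set fun r hr => hxa'.trans_le hr.1)
        (fun r hr => (hzeros _ r (hpos r hr)).1)
        (fun r hr => reg_nontrivial V₁ ℓ k hk0 _ hint₁' (hψ₁ _) r (hpos r hr))
        (fun r hr => reg_nontrivial V₂ ℓ k hk0 _ hint₂' (hψ₂ _) r (hpos r hr)) c
      simp only [add_sub_add_right_eq_sub] at hcore
      have h10 : 0 < 10 / k := by positivity
      have hle : ∫ r in Icc x (x + 10 / k), |V₁ r - V₂ r - c| ≤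
          ∫ y in Metric.closedBall x (10 / k), ‖f y - f x‖ := by
        have e1 : ∫ r in Icc x (x + 10 / k), |V₁ r - V₂ r - c| =
            ∫ r in Icc x (x + 10 / k), ‖f r - f x‖ := by
          refine setIntegral_congr_fun measurableSet_Icc fun r hr => ?_
          have hr' : r ∈ Ioi a := hxa'.trans_le hr.1
          simp only [hf, indicator_of_mem hr', indicator_of_mem hxa, Real.norm_eq_abs, hc]
        rw [e1, Real.closedBall_eq_Icc]
        refine setIntegral_mono_set ?_ (Eventually.of_forall fun _ => norm_nonneg _)
          (LE.le.eventuallyLE (Icc_subset_Icc (by linarith) le_rfl))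
        exact (hfi.integrableOn.sub (integrableOn_const (by simp))).norm
      rw [setAverage_eq, Real.volume_real_closedBall h10.le, smul_eq_mul]
      have h3 : |c| / k ≤ 8 * ∫ y in Metric.closedBall x (10 / k), ‖f y - f x‖ := by linarith
      rw [div_le_iff₀ hk0] at h3
      refine h3.trans (le_of_eq ?_)
      field_simp
      ring
    have hlim' := hlim.const_mul 160
    rw [mul_zero] at hlim'
    have h0 : |c| ≤ 0 := ge_of_tendsto hlim' hbound
    have : c = 0 := abs_nonpos_iff.1 h0
    linarith
  filter_upwards [ae_all_iff.2 main] with x hx hx0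
  obtain ⟨n, hn⟩ := exists_nat_one_div_lt (show (0 : ℝ) < x from hx0)
  exact hx n hn
end

section
/- Fix k₀ > 0. Let V₁, V₂ : (0,∞) → ℝ be measurable with ∫₀^∞ |Vᵢ(r)| dr < ∞ and ∫₀^∞ r |Vᵢ(r)| dr < ∞ for i = 1, 2. For each i define gᵢ(q) = ∫₀^∞ sin(qr) · r Vᵢ(r) dr and Fᵢ(k) = −∫₀^∞ sin(kr)² Vᵢ(r) dr. Suppose the mixed Born data coincide: gᵢ agree at fixed energy, i.e. g₁(q) = g₂(q) for all q ∈ (0, 2k₀], and the s-wave Born phase data agree above k₀, i.e. F₁(k) = F₂(k) for all k ≥ k₀. Then V₁ = V₂ almost everywhere on (0,∞). That is, in the Born approximation the mixed data {δ(ℓ, k₀) : ℓ ∈ ℕ} ∪ {δ(ℓ=0, k) : k ≥ k₀} determine the potential uniquely. -/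
open Set Filter Topology MeasureTheory

section BornHelpers
open scoped FourierTransform ContDiff

/-- An integrable function with vanishing Fourier transform vanishes almost everywhere. -/
theorem born_fourier_injective (f : ℝ → ℂ) (hf : Integrable f) (h : ∀ w, 𝓕 f w = 0) :
    ∀ᵐ x, f x = 0 := by
  apply ae_eq_zero_of_integral_contDiff_smul_eq_zero hf.locallyIntegrable
  intro g g_smooth g_cpt
  have hg₁ : HasCompactSupport (Complex.ofRealCLM ∘ g) := g_cpt.comp_left rfl
  have hg₂ : ContDiff ℝ ∞ (Complex.ofRealCLM ∘ g) := by fun_prop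
  set φ : SchwartzMap ℝ ℂ := hg₁.toSchwartzMap hg₂ with hφ
  set ψ : SchwartzMap ℝ ℂ := 𝓕⁻ φ with hψ
  have h1 : 𝓕 ψ = φ := FourierTransform.fourier_fourierInv_eq φ
  have h2 : ∀ x, 𝓕 (ψ : ℝ → ℂ) x = (g x : ℂ) := by
    intro x
    rw [← SchwartzMap.fourier_coe, h1]
    simp [hφ]
  have key : ∫ x, 𝓕 (ψ : ℝ → ℂ) x • f x = ∫ x, ψ x • 𝓕 f x := by
    simpa using! (VectorFourier.integral_fourierIntegral_smul_eq_flip (L := innerₗ ℝ)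
      Real.continuous_fourierChar continuous_inner ψ.integrable hf)
  simp only [h2, h, smul_zero, integral_zero] at key
  simpa using key

/-- Injectivity of the sine transform on the half line. -/
theorem born_sine_injective (W : ℝ → ℝ) (hm : Measurable W)
    (hi : IntegrableOn (fun r => r * W r) (Set.Ioi 0))
    (h : ∀ q > 0, ∫ r in Set.Ioi (0 : ℝ), Real.sin (q * r) * (r * W r) = 0) :
    ∀ᵐ r ∂(volume : Measure ℝ), r ∈ Set.Ioi (0 : ℝ) → W r = 0 := by
  have hall : ∀ q : ℝ, ∫ r in Set.Ioi (0 : ℝ), Real.sin (q * r) * (r * W r) = 0 := by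
    intro q
    rcases lt_trichotomy q 0 with hq | hq | hq
    · have := h (-q) (by linarith)
      simp only [neg_mul, Real.sin_neg, integral_neg] at this
      linarith
    · simp [hq]
    · exact h q hq
  set f : ℝ → ℝ := fun x => x * W |x| with hf
  have hfm : Measurable f := by fun_prop
  have hfpos : IntegrableOn f (Set.Ioi 0) := by
    refine hi.congr_fun ?_ measurableSet_Ioi
    intro x hx
    simp [hf, abs_of_pos (show (0:ℝ) < x from hx)]
  have hfi : Integrable f := by
    rw [← integrableOn_univ, ← Set.Iic_union_Ioi (a := (0:ℝ))]
    refine IntegrableOn.union ?_ hfpos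
    rw [integrableOn_Iic_iff_integrableOn_Iio]
    have := hfpos.comp_neg
    simp only [Set.neg_Ioi, neg_zero] at this
    refine this.neg.congr_fun ?_ measurableSet_Iio
    intro x _
    simp [hf]
  have hF : ∀ w, 𝓕 (fun x => (f x : ℂ)) w = 0 := by
    intro w
    rw [Real.fourier_real_eq_integral_exp_smul]
    have e : ∀ v : ℝ, Complex.exp (↑(-2 * Real.pi * v * w) * Complex.I) • (f v : ℂ)
        = ((Real.cos (2 * Real.pi * w * v) * f v : ℝ) : ℂ)
          - ((Real.sin (2 * Real.pi * w * v) * f v : ℝ) : ℂ) * Complex.I := by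
      intro v
      rw [Complex.exp_mul_I, ← Complex.ofReal_cos, ← Complex.ofReal_sin,
        show -2 * Real.pi * v * w = -(2 * Real.pi * w * v) by ring, Real.cos_neg, Real.sin_neg]
      push_cast
      simp only [smul_eq_mul]
      ring
    simp_rw [e]
    have i1 : Integrable (fun v => Real.cos (2 * Real.pi * w * v) * f v) :=
      hfi.bdd_mul (c := 1) (by fun_prop) (ae_of_all _ fun x => by
        simpa using Real.abs_cos_le_one _)
    have i2 : Integrable (fun v => Real.sin (2 * Real.pi * w * v) * f v) :=
      hfi.bdd_mul (c := 1) (by fun_prop) (ae_of_all _ fun x => by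
        simpa using Real.abs_sin_le_one _)
    rw [integral_sub i1.ofReal (i2.ofReal.mul_const _), integral_mul_const,
      integral_complex_ofReal, integral_complex_ofReal]
    have z1 : ∫ v, Real.cos (2 * Real.pi * w * v) * f v = 0 := by
      have := integral_neg_eq_self (fun v => Real.cos (2 * Real.pi * w * v) * f v) volume
      simp only [hf, abs_neg, mul_neg, neg_mul, Real.cos_neg, integral_neg] at this ⊢
      linarith
    have z2 : ∫ v, Real.sin (2 * Real.pi * w * v) * f v = 0 := by
      have := integral_comp_abs (f := fun r => Real.sin (2 * Real.pi * w * r) * (r * W r))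
      rw [hall, mul_zero] at this
      rw [← this]
      congr 1
      ext x
      rcases abs_choice x with hx | hx <;> simp [hf, hx]
    rw [z1, z2]
    simp
  have := born_fourier_injective _ hfi.ofReal hF
  filter_upwards [this] with x hx hx0
  have hx0 : 0 < x := hx0
  have : f x = 0 := Complex.ofReal_eq_zero.mp hx
  simpa [hf, abs_of_pos hx0, hx0.ne'] using this

/-- Differentiating the s-wave Born data gives the sine transform. -/
theorem born_hasDerivAt (W : ℝ → ℝ) (hm : Measurable W)
    (h0 : IntegrableOn W (Set.Ioi 0))
    (hi : IntegrableOn (fun r => r * W r) (Set.Ioi 0)) (k : ℝ) :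
    HasDerivAt (fun k => ∫ r in Set.Ioi (0 : ℝ), Real.sin (k * r) ^ 2 * W r)
      (∫ r in Set.Ioi (0 : ℝ), Real.sin ((2 * k) * r) * (r * W r)) k := by
  refine (hasDerivAt_integral_of_dominated_loc_of_deriv_le (s := Set.univ)
    (F' := fun k r => Real.sin ((2 * k) * r) * (r * W r))
    (bound := fun r => ‖r * W r‖) Filter.univ_mem ?_ ?_ ?_ ?_ ?_ ?_).2
  · exact Filter.Eventually.of_forall fun x => (by fun_prop : Measurable _).aestronglyMeasurable
  · refine h0.bdd_mul (c := 1) (by fun_prop) (ae_of_all _ fun x => ?_)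
    rw [norm_pow]
    exact pow_le_one₀ (norm_nonneg _) (by simpa using Real.abs_sin_le_one _)
  · exact (by fun_prop : Measurable _).aestronglyMeasurable
  · refine ae_of_all _ fun r x _ => ?_
    rw [norm_mul]
    exact mul_le_of_le_one_left (norm_nonneg _) (by simpa using Real.abs_sin_le_one _)
  · exact hi.norm
  · refine ae_of_all _ fun r x _ => ?_
    have h1 : HasDerivAt (fun x : ℝ => x * r) r x := by
      simpa using (hasDerivAt_id x).mul_const r
    refine ((h1.sin.pow 2).mul_const (W r)).congr_deriv ?_
    rw [mul_assoc 2 x r, Real.sin_two_mul]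
    simp
    ring

end BornHelpers

/-- In the Born approximation, the mixed data
`{δ(ℓ, k₀) : ℓ ∈ ℕ} ∪ {δ(0, k) : k ≥ k₀}` determine the potential uniquely:
the fixed-energy data are equivalent to the sine transform
`g(q) = ∫₀^∞ sin(qr) r V(r) dr` for `0 < q ≤ 2k₀`, and the s-wave Born phase
data are the function `F(k) = k δ_Born(0,k) = −∫₀^∞ sin(kr)² V(r) dr` for
`k ≥ k₀`. If two integrable potentials have the same mixed Born data, they
coincide almost everywhere on `(0,∞)`. -/
theorem potential_unique_from_mixed_born_data
    (k₀ : ℝ) (hk₀ : 0 < k₀)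
    (V₁ V₂ : ℝ → ℝ) (hmeas₁ : Measurable V₁) (hmeas₂ : Measurable V₂)
    (hint₁ : IntegrableOn V₁ (Set.Ioi 0))
    (hint₁' : IntegrableOn (fun r => r * V₁ r) (Set.Ioi 0))
    (hint₂ : IntegrableOn V₂ (Set.Ioi 0))
    (hint₂' : IntegrableOn (fun r => r * V₂ r) (Set.Ioi 0))
    -- the fixed-energy data coincide: g₁(q) = g₂(q) for 0 < q ≤ 2k₀
    (hg : ∀ q ∈ Set.Ioc (0 : ℝ) (2 * k₀),
      ∫ r in Set.Ioi (0 : ℝ), Real.sin (q * r) * (r * V₁ r) =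
      ∫ r in Set.Ioi (0 : ℝ), Real.sin (q * r) * (r * V₂ r))
    -- the s-wave Born phase data coincide: F₁(k) = F₂(k) for k ≥ k₀
    (hF : ∀ k : ℝ, k₀ ≤ k →
      (-∫ r in Set.Ioi (0 : ℝ), Real.sin (k * r) ^ 2 * V₁ r) =
      (-∫ r in Set.Ioi (0 : ℝ), Real.sin (k * r) ^ 2 * V₂ r)) :
    ∀ᵐ r ∂(volume : Measure ℝ), r ∈ Set.Ioi (0 : ℝ) → V₁ r = V₂ r := by
  have sinint : ∀ (V : ℝ → ℝ), IntegrableOn (fun r => r * V r) (Set.Ioi 0) → ∀ q : ℝ,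
      IntegrableOn (fun r => Real.sin (q * r) * (r * V r)) (Set.Ioi 0) := fun V hV q =>
    hV.bdd_mul (c := 1) (by fun_prop) (ae_of_all _ fun x => by
      simpa using Real.abs_sin_le_one _)
  have hall : ∀ q > 0, ∫ r in Set.Ioi (0 : ℝ), Real.sin (q * r) * (r * V₁ r) =
      ∫ r in Set.Ioi (0 : ℝ), Real.sin (q * r) * (r * V₂ r) := by
    intro q hq
    rcases le_or_gt q (2 * k₀) with hle | hlt
    · exact hg q ⟨hq, hle⟩
    · have d1 := born_hasDerivAt V₁ hmeas₁ hint₁ hint₁' (q / 2)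
      have d2 := born_hasDerivAt V₂ hmeas₂ hint₂ hint₂' (q / 2)
      rw [mul_div_cancel₀ q (two_ne_zero)] at d1 d2
      refine d1.unique (d2.congr_of_eventuallyEq ?_)
      filter_upwards [Ioi_mem_nhds (show k₀ < q / 2 by linarith)] with k hk
      exact neg_injective (hF k (le_of_lt hk))
  have key := born_sine_injective (fun r => V₁ r - V₂ r) (hmeas₁.sub hmeas₂)
    (by simpa only [mul_sub] using! hint₁'.sub hint₂') (fun q hq => by
      simp only [mul_sub]
      rw [integral_sub (sinint V₁ hint₁' q) (sinint V₂ hint₂' q), hall q hq, sub_self])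
  filter_upwards [key] with r hr h0
  exact sub_eq_zero.mp (hr h0)
end
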